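/- arXiv:2512.00559 — 2 statements merged into one kernel-verified Lean document; each statement's English description precedes it below -/
import Mathlib

section
/- Let D₀ > 0 and let w, G, φ : ℝ × ℝ → ℝ with w(x,t) > 0 for all x, t. Assume that for each fixed t the functions x ↦ w(x,t), x ↦ G(x,t), x ↦ φ(x,t) are twice differentiable and t ↦ w(x,t), t ↦ G(x,t) are differentiable. Suppose w satisfies the weight equation ∂ₜw(x,t) = D₀ · ∂ₓ(∂ₓw(x,t) + ∂ₓφ(x,t)·w(x,t)) and G satisfies the envelope equation ∂ₜG(x,t) = D₀ · ( (∂ₓφ(x,t) + 2·∂ₓw(x,t)/w(x,t))·∂ₓG(x,t) + ∂ₓ²G(x,t) ) for all x, t. Then the product p(x,t) := w(x,t)·G(x,t) satisfies the Fokker–Planck equation ∂ₜp(x,t) = D₀ · ∂ₓ(∂ₓp(x,t) + ∂ₓφ(x,t)·p(x,t)) for all x, t. -/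
/-- If `w > 0` satisfies the weight equation and `G` satisfies the
envelope equation `∂ₜG = D₀ ((∂ₓφ + 2 ∂ₓw/w) ∂ₓG + ∂ₓ²G)`, then the product
`p = w · G` satisfies the Fokker–Planck equation `∂ₜp = D₀ ∂ₓ(∂ₓp + ∂ₓφ · p)`. -/
theorem product_weight_envelope_solves_fokker_planck
    (D₀ : ℝ) (hD₀ : 0 < D₀)
    (w G φ : ℝ → ℝ → ℝ)
    (hw_pos : ∀ x t : ℝ, 0 < w x t)
    (hw_diff : ∀ t : ℝ, Differentiable ℝ (fun x => w x t))
    (hw_diff2 : ∀ t : ℝ, Differentiable ℝ (deriv (fun x => w x t)))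
    (hG_diff : ∀ t : ℝ, Differentiable ℝ (fun x => G x t))
    (hG_diff2 : ∀ t : ℝ, Differentiable ℝ (deriv (fun x => G x t)))
    (hφ_diff : ∀ t : ℝ, Differentiable ℝ (fun x => φ x t))
    (hφ_diff2 : ∀ t : ℝ, Differentiable ℝ (deriv (fun x => φ x t)))
    (hw_t_diff : ∀ x : ℝ, Differentiable ℝ (fun t => w x t))
    (hG_t_diff : ∀ x : ℝ, Differentiable ℝ (fun t => G x t))
    (hweight : ∀ x t : ℝ,
      deriv (fun s => w x s) t =
        D₀ * deriv (fun y => deriv (fun z => w z t) y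
            + deriv (fun z => φ z t) y * w y t) x)
    (henvelope : ∀ x t : ℝ,
      deriv (fun s => G x s) t =
        D₀ * ((deriv (fun y => φ y t) x
                + 2 * deriv (fun y => w y t) x / w x t)
              * deriv (fun y => G y t) x
            + deriv (deriv (fun y => G y t)) x)) :
    ∀ x t : ℝ,
      deriv (fun s => w x s * G x s) t =
        D₀ * deriv (fun y => deriv (fun z => w z t * G z t) y
            + deriv (fun z => φ z t) y * (w y t * G y t)) x := by
  intro x t
  have hw y := (hw_diff t y).hasDerivAt
  have hG y := (hG_diff t y).hasDerivAt
  have hw' := (hw_diff2 t x).hasDerivAt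
  have hG' := (hG_diff2 t x).hasDerivAt
  have hφ' := (hφ_diff2 t x).hasDerivAt
  have hprod : ∀ y, deriv (fun z => w z t * G z t) y =
      deriv (fun z => w z t) y * G y t + w y t * deriv (fun z => G z t) y :=
    fun y => ((hw y).mul (hG y)).deriv
  have hprod_t : deriv (fun s => w x s * G x s) t =
      deriv (fun s => w x s) t * G x t + w x t * deriv (fun s => G x s) t :=
    ((hw_t_diff x t).hasDerivAt.mul (hG_t_diff x t).hasDerivAt).deriv
  have hflux_w : deriv (fun y => deriv (fun z => w z t) y
      + deriv (fun z => φ z t) y * w y t) x = _ :=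
    (hw'.add (hφ'.mul (hw x))).deriv
  have hflux_p : deriv (fun y => (deriv (fun z => w z t) y * G y t
      + w y t * deriv (fun z => G z t) y)
      + deriv (fun z => φ z t) y * (w y t * G y t)) x = _ :=
    (((hw'.mul (hG x)).add ((hw x).mul hG')).add (hφ'.mul ((hw x).mul (hG x)))).deriv
  simp only [hprod]
  rw [hprod_t, hweight, henvelope, hflux_w, hflux_p]
  have hw_ne : w x t ≠ 0 := (hw_pos x t).ne'
  simp only [Pi.mul_apply]
  field_simp
  ring
end

section
/- Let D₀ > 0, A, B, C, ω ∈ ℝ with B > |A| + |C|, and let f : ℝ → ℝ be any function. Define w(x,t) = B + A·cos(ωt)·cos(x) + C·cos(x) and define the force field F(x,t) = ( f(t) + (C + A·cos(ωt) − (Aω/D₀)·sin(ωt))·sin(x) ) / w(x,t). Then w is everywhere positive and satisfies the weight equation with ∂ₓφ = F, namely ∂ₜw(x,t) = D₀ · ∂ₓ( ∂ₓw(x,t) + F(x,t)·w(x,t) ) for all x, t. In particular, for every choice of the function f the same Boltzmann weight w solves the weight equation. -/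
/-- The weight `B + A cos u cos x + C cos x` is positive when `|A| + |C| < B`. -/
lemma weight_pos {A B C : ℝ} (hB : |A| + |C| < B) (u x : ℝ) :
    0 < B + A * Real.cos u * Real.cos x + C * Real.cos x := by
  have hA : |A * Real.cos u * Real.cos x| ≤ |A| := by
    rw [mul_assoc, abs_mul, abs_mul]
    exact mul_le_of_le_one_right (abs_nonneg A)
      (mul_le_one₀ (Real.abs_cos_le_one u) (abs_nonneg _) (Real.abs_cos_le_one x))
  have hC : |C * Real.cos x| ≤ |C| := by
    rw [abs_mul]
    exact mul_le_of_le_one_right (abs_nonneg C) (Real.abs_cos_le_one x)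
  linarith [(abs_le.mp hA).1, (abs_le.mp hC).1]

lemma hasDerivAt_weight_space (a B C y : ℝ) :
    HasDerivAt (fun z => B + a * Real.cos z + C * Real.cos z) (-((a + C) * Real.sin y)) y := by
  refine ((((Real.hasDerivAt_cos y).const_mul a).const_add B).add
    ((Real.hasDerivAt_cos y).const_mul C)).congr_deriv ?_
  ring

lemma hasDerivAt_weight_time (A B C ω x t : ℝ) :
    HasDerivAt (fun s => B + A * Real.cos (ω * s) * Real.cos x + C * Real.cos x)
      (-(A * ω * Real.sin (ω * t) * Real.cos x)) t := by
  have h : HasDerivAt (fun s => Real.cos (ω * s)) (-Real.sin (ω * t) * (ω * 1)) t :=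
    ((hasDerivAt_id' t).const_mul ω).cos
  refine ((((h.const_mul A).mul_const (Real.cos x)).const_add B).add_const
    (C * Real.cos x)).congr_deriv ?_
  ring

/-- the exactly solvable model. With
`w(x,t) = B + A cos(ωt) cos x + C cos x` (positive since `B > |A| + |C|`) and force
field `F(x,t) = (f(t) + (C + A cos(ωt) − (Aω/D₀) sin(ωt)) sin x) / w(x,t)`,
`w` satisfies the weight equation `∂ₜw = D₀ ∂ₓ(∂ₓw + F·w)` for every choice of `f`. -/
theorem exact_model_solves_weight_eq
    (D₀ A B C ω : ℝ) (hD₀ : 0 < D₀) (hB : |A| + |C| < B) (f : ℝ → ℝ) :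
    (∀ x t : ℝ,
      0 < B + A * Real.cos (ω * t) * Real.cos x + C * Real.cos x) ∧
    (∀ x t : ℝ,
      deriv (fun s => B + A * Real.cos (ω * s) * Real.cos x + C * Real.cos x) t =
        D₀ * deriv (fun y =>
          deriv (fun z => B + A * Real.cos (ω * t) * Real.cos z + C * Real.cos z) y
          + ((f t + (C + A * Real.cos (ω * t) - A * ω / D₀ * Real.sin (ω * t))
                * Real.sin y)
              / (B + A * Real.cos (ω * t) * Real.cos y + C * Real.cos y))
            * (B + A * Real.cos (ω * t) * Real.cos y + C * Real.cos y)) x) := by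
  refine ⟨fun x t => weight_pos hB (ω * t) x, fun x t => ?_⟩
  have hflux : (fun y =>
      deriv (fun z => B + A * Real.cos (ω * t) * Real.cos z + C * Real.cos z) y
      + ((f t + (C + A * Real.cos (ω * t) - A * ω / D₀ * Real.sin (ω * t)) * Real.sin y)
          / (B + A * Real.cos (ω * t) * Real.cos y + C * Real.cos y))
        * (B + A * Real.cos (ω * t) * Real.cos y + C * Real.cos y)) =
      fun y => f t + -(A * ω / D₀ * Real.sin (ω * t)) * Real.sin y := by
    funext y
    rw [(hasDerivAt_weight_space _ B C y).deriv, div_mul_cancel₀ _ (weight_pos hB (ω * t) y).ne']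
    ring
  rw [hflux, (((Real.hasDerivAt_sin x).const_mul _).const_add _).deriv,
    (hasDerivAt_weight_time A B C ω x t).deriv]
  field_simp
end
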